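/- arXiv:1910.09857 — 11 statements merged into one kernel-verified Lean document; each statement's English description precedes it below -/
import Mathlib

section
/- The matrix (I_m − G H) P is symmetric positive definite (in particular invertible), and its inverse satisfies ((I_m − G H) P)⁻¹ = P⁻¹ + r⁻¹ Hᵀ H; equivalently, (I_m − G H) P = (P⁻¹ + r⁻¹ Hᵀ H)⁻¹. Consequently, for any q ≥ 0 the updated covariance P' = (I_m − G H) P + q·I_m is symmetric positive definite, and (P' − q·I_m)⁻¹ = P⁻¹ + r⁻¹ Hᵀ H is positive definite. -/
open Matrix

/-- The Kalman covariance update is a left inverse of the updated information matrix. -/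
theorem kalman_update_mul_information {K m n : Type*} [Field K] [Fintype m] [DecidableEq m]
    [Fintype n] [DecidableEq n] {P : Matrix m m K} {H : Matrix n m K} {r : K}
    {G : Matrix m n K} (hP : IsUnit P) (hr : r ≠ 0) (hM : IsUnit (H * P * Hᵀ + r • 1))
    (hG : G = P * Hᵀ * (H * P * Hᵀ + r • 1)⁻¹) :
    (1 - G * H) * P * (P⁻¹ + r⁻¹ • (Hᵀ * H)) = 1 := by
  have hPP : P * P⁻¹ = 1 := mul_nonsing_inv P ((isUnit_iff_isUnit_det P).1 hP)
  have hGM : G * (H * P * Hᵀ + r • 1) = P * Hᵀ := by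
    rw [hG, nonsing_inv_mul_cancel_right _ _ ((isUnit_iff_isUnit_det _).1 hM)]
  have hGHP : G * (H * P * Hᵀ) = P * Hᵀ - r • G := by
    rw [← hGM, Matrix.mul_add, Matrix.mul_smul, Matrix.mul_one, add_sub_cancel_right]
  calc (1 - G * H) * P * (P⁻¹ + r⁻¹ • (Hᵀ * H))
      = (1 - G * H) * (P * P⁻¹) + r⁻¹ • (P * Hᵀ * H - G * (H * P * Hᵀ) * H) := by
        simp only [Matrix.mul_add, Matrix.sub_mul, Matrix.one_mul, Matrix.mul_smul, smul_sub,
          Matrix.mul_assoc]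
    _ = 1 := by
        rw [hGHP, hPP, Matrix.mul_one, Matrix.sub_mul, sub_sub_cancel, Matrix.smul_mul,
          inv_smul_smul₀ hr, sub_add_cancel]

/-- `(I - G H) P` is symmetric positive definite with inverse
`P⁻¹ + r⁻¹ Hᵀ H`; for any `q ≥ 0` the updated covariance
`P' = (I - G H) P + q I` is symmetric positive definite and
`(P' - q I)⁻¹ = P⁻¹ + r⁻¹ Hᵀ H` is positive definite. -/
theorem kalman_cov_update_posdef {n m : ℕ} (hn : 0 < n) (hm : 0 < m)
    (P : Matrix (Fin m) (Fin m) ℝ) (H : Matrix (Fin n) (Fin m) ℝ) (r : ℝ)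
    (hP : P.PosDef) (hr : 0 < r)
    (M : Matrix (Fin n) (Fin n) ℝ)
    (hM : M = H * P * Hᵀ + r • (1 : Matrix (Fin n) (Fin n) ℝ))
    (G : Matrix (Fin m) (Fin n) ℝ) (hG : G = P * Hᵀ * M⁻¹) :
    ((1 - G * H) * P).PosDef ∧
    ((1 - G * H) * P)⁻¹ = P⁻¹ + r⁻¹ • (Hᵀ * H) ∧
    (1 - G * H) * P = (P⁻¹ + r⁻¹ • (Hᵀ * H))⁻¹ ∧
    (∀ q : ℝ, 0 ≤ q →
      ((1 - G * H) * P + q • (1 : Matrix (Fin m) (Fin m) ℝ)).PosDef ∧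
      (((1 - G * H) * P + q • (1 : Matrix (Fin m) (Fin m) ℝ)) -
          q • (1 : Matrix (Fin m) (Fin m) ℝ))⁻¹ = P⁻¹ + r⁻¹ • (Hᵀ * H) ∧
      (P⁻¹ + r⁻¹ • (Hᵀ * H)).PosDef) := by
  have hMpos : M.PosDef := by
    rw [hM]
    exact (PosDef.one.smul hr).posSemidef_add
      (by simpa using hP.posSemidef.mul_mul_conjTranspose_same H)
  have hJ : (P⁻¹ + r⁻¹ • (Hᵀ * H)).PosDef :=
    hP.inv.add_posSemidef
      ((by simpa using posSemidef_conjTranspose_mul_self H : (Hᵀ * H).PosSemidef).smul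
        (inv_nonneg.2 hr.le))
  have hright : ((1 - G * H) * P) * (P⁻¹ + r⁻¹ • (Hᵀ * H)) = 1 :=
    kalman_update_mul_information hP.isUnit hr.ne' (hM ▸ hMpos.isUnit) (hM ▸ hG)
  have hinv : ((1 - G * H) * P)⁻¹ = P⁻¹ + r⁻¹ • (Hᵀ * H) := inv_eq_right_inv hright
  have heq : (1 - G * H) * P = (P⁻¹ + r⁻¹ • (Hᵀ * H))⁻¹ := (inv_eq_left_inv hright).symm
  have hpos : ((1 - G * H) * P).PosDef := heq ▸ hJ.inv
  refine ⟨hpos, hinv, heq, fun q hq => ⟨?_, ?_, hJ⟩⟩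
  · exact hpos.add_posSemidef (PosSemidef.one.smul hq)
  · rw [add_sub_cancel_right, hinv]
end

section
/- The trace of the covariance after the Kalman measurement update does not exceed the trace before the update: Tr((I_m − G H) P) ≤ Tr(P). Consequently, for any q ≥ 0, the updated covariance P' = (I_m − G H) P + q·I_m satisfies Tr(P') ≤ Tr(P) + q·m. -/
open Matrix

/-- The covariance reduction `P Hᵀ M⁻¹ H P` of a Kalman measurement update with innovation
covariance `M = H P Hᵀ + r I` is positive semidefinite. -/
theorem posSemidef_kalman_reduction {ι κ : Type*} [Fintype ι] [DecidableEq ι] [Fintype κ]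
    {P : Matrix κ κ ℝ} (hP : P.PosSemidef) (H : Matrix ι κ ℝ) {r : ℝ} (hr : 0 ≤ r) :
    (P * Hᵀ * (H * P * Hᵀ + r • (1 : Matrix ι ι ℝ))⁻¹ * H * P).PosSemidef := by
  have hM : (H * P * Hᵀ + r • (1 : Matrix ι ι ℝ)).PosSemidef := by
    simpa using (hP.mul_mul_conjTranspose_same H).add (PosSemidef.one.smul hr)
  have hPt : Pᵀ = P := by simpa using hP.isHermitian.eq
  simpa [hPt, Matrix.mul_assoc] using hM.inv.mul_mul_conjTranspose_same (P * Hᵀ)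

/-- the trace does not increase under the Kalman measurement
update: `Tr((I - G H) P) ≤ Tr(P)`; hence for `q ≥ 0`,
`Tr((I - G H) P + q I) ≤ Tr(P) + q m`. -/
theorem kalman_trace_bound {n m : ℕ} (hn : 0 < n) (hm : 0 < m)
    (P : Matrix (Fin m) (Fin m) ℝ) (H : Matrix (Fin n) (Fin m) ℝ) (r : ℝ)
    (hP : P.PosDef) (hr : 0 < r)
    (M : Matrix (Fin n) (Fin n) ℝ)
    (hM : M = H * P * Hᵀ + r • (1 : Matrix (Fin n) (Fin n) ℝ))
    (G : Matrix (Fin m) (Fin n) ℝ) (hG : G = P * Hᵀ * M⁻¹) :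
    ((1 - G * H) * P).trace ≤ P.trace ∧
    (∀ q : ℝ, 0 ≤ q →
      ((1 - G * H) * P + q • (1 : Matrix (Fin m) (Fin m) ℝ)).trace ≤
        P.trace + q * m) := by
  have htrace : ((1 - G * H) * P).trace ≤ P.trace := by
    subst hM hG
    rw [Matrix.sub_mul, Matrix.one_mul, trace_sub]
    exact sub_le_self _ (posSemidef_kalman_reduction hP.posSemidef H hr.le).trace_nonneg
  refine ⟨htrace, fun q _ ↦ ?_⟩
  simpa [trace_add, trace_smul] using htrace
end

section
/- The matrix I_n − H P Hᵀ M⁻¹ equals r·M⁻¹ and is symmetric positive semidefinite; in particular, for every x ∈ ℝ^n one has xᵀ H P Hᵀ M⁻¹ x ≤ ‖x‖², i.e. H P Hᵀ M⁻¹ ⪯ I_n in the Loewner order. -/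
open Matrix

/-- Adding a positive multiple of the identity to a real congruence `H P Hᵀ` of a positive
semidefinite matrix gives a positive definite matrix. -/
theorem Matrix.PosSemidef.posDef_mul_mul_transpose_add_smul_one {n m : ℕ}
    {P : Matrix (Fin m) (Fin m) ℝ} (hP : P.PosSemidef) (H : Matrix (Fin n) (Fin m) ℝ) {r : ℝ}
    (hr : 0 < r) : (H * P * Hᵀ + r • (1 : Matrix (Fin n) (Fin n) ℝ)).PosDef := by
  have h := hP.mul_mul_conjTranspose_same H
  rw [conjTranspose_eq_transpose_of_trivial] at h
  exact Matrix.PosDef.posSemidef_add h (Matrix.PosDef.one.smul hr)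

/-- `I - H P Hᵀ M⁻¹ = r M⁻¹` is symmetric positive semidefinite;
in particular `xᵀ H P Hᵀ M⁻¹ x ≤ ‖x‖²` for all `x`, i.e.
`H P Hᵀ M⁻¹ ⪯ I` in the Loewner order. -/
theorem kalman_innovation_bound {n m : ℕ} (hn : 0 < n) (hm : 0 < m)
    (P : Matrix (Fin m) (Fin m) ℝ) (H : Matrix (Fin n) (Fin m) ℝ) (r : ℝ)
    (hP : P.PosDef) (hr : 0 < r)
    (M : Matrix (Fin n) (Fin n) ℝ)
    (hM : M = H * P * Hᵀ + r • (1 : Matrix (Fin n) (Fin n) ℝ)) :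
    (1 : Matrix (Fin n) (Fin n) ℝ) - H * P * Hᵀ * M⁻¹ = r • M⁻¹ ∧
    ((1 : Matrix (Fin n) (Fin n) ℝ) - H * P * Hᵀ * M⁻¹).PosSemidef ∧
    (∀ x : Fin n → ℝ, x ⬝ᵥ ((H * P * Hᵀ * M⁻¹) *ᵥ x) ≤ x ⬝ᵥ x) := by
  have hMpos : M.PosDef := hM ▸ hP.posSemidef.posDef_mul_mul_transpose_add_smul_one H hr
  have hsub : (1 : Matrix (Fin n) (Fin n) ℝ) - H * P * Hᵀ * M⁻¹ = r • M⁻¹ := by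
    have hHPH : H * P * Hᵀ = M - r • (1 : Matrix (Fin n) (Fin n) ℝ) := by
      rw [hM, add_sub_cancel_right]
    rw [hHPH, Matrix.sub_mul, Matrix.mul_nonsing_inv M ((isUnit_iff_isUnit_det M).1 hMpos.isUnit),
      Matrix.smul_mul, Matrix.one_mul, sub_sub_cancel]
  have hpsd : ((1 : Matrix (Fin n) (Fin n) ℝ) - H * P * Hᵀ * M⁻¹).PosSemidef :=
    hsub ▸ (hMpos.inv.smul hr).posSemidef
  refine ⟨hsub, hpsd, fun x => ?_⟩
  have hx := hpsd.dotProduct_mulVec_nonneg x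
  rw [star_trivial, sub_mulVec, one_mulVec, dotProduct_sub] at hx
  exact sub_nonneg.1 hx
end

section
/- The following Loewner-order bound holds: Gᵀ ((I_m − G H) P)⁻¹ G + M⁻¹ ⪯ (3/r)·I_n; that is, for every ζ ∈ ℝ^n, ζᵀ Gᵀ ((I_m − G H) P)⁻¹ G ζ + ζᵀ M⁻¹ ζ ≤ 3‖ζ‖²/r. (This bound is the source of the factor 3 in the measurement-noise selection r = 3·Tr(H P Hᵀ)/n of the algorithm.) -/
open Matrix

section Kalman

variable {ι κ : Type*} [Fintype ι] [Fintype κ] [DecidableEq κ]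
  {P : Matrix κ κ ℝ} {H : Matrix ι κ ℝ} {G : Matrix κ ι ℝ} {M : Matrix ι ι ℝ} {r : ℝ}

/-- Applying the posterior covariance to `Hᵀ` gives `r` times the gain. -/
lemma posterior_mul_transpose (hgain : G * (H * P * Hᵀ) + r • G = P * Hᵀ) :
    (1 - G * H) * P * Hᵀ = r • G := by
  rw [Matrix.sub_mul, Matrix.sub_mul, Matrix.one_mul, ← hgain]
  simp only [Matrix.mul_assoc]
  abel

/-- The information form of the posterior covariance: its inverse is `P⁻¹ + r⁻¹ Hᵀ H`. -/
lemma posterior_mul_information (hr : r ≠ 0) (hP : IsUnit P.det)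
    (hgain : G * (H * P * Hᵀ) + r • G = P * Hᵀ) :
    (1 - G * H) * P * (P⁻¹ + r⁻¹ • (Hᵀ * H)) = 1 := by
  rw [Matrix.mul_add, mul_nonsing_inv_cancel_right _ _ hP, Matrix.mul_smul, ← Matrix.mul_assoc,
    posterior_mul_transpose hgain, Matrix.smul_mul, inv_smul_smul₀ hr, sub_add_cancel]

/-- The Loewner bound for the Kalman gain is an identity with constant `r⁻¹`. -/
lemma transpose_gain_mul_inv_mul_gain_add_inv [DecidableEq ι] (hr : r ≠ 0)
    (hP : IsUnit P.det) (hMunit : IsUnit M.det) (hPsymm : Pᵀ = P) (hMsymm : Mᵀ = M)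
    (hM : M = H * P * Hᵀ + r • (1 : Matrix ι ι ℝ)) (hG : G = P * Hᵀ * M⁻¹) :
    Gᵀ * ((1 - G * H) * P)⁻¹ * G + M⁻¹ = r⁻¹ • (1 : Matrix ι ι ℝ) := by
  have hgain : G * (H * P * Hᵀ) + r • G = P * Hᵀ := by
    have h : G * M = P * Hᵀ := by rw [hG, nonsing_inv_mul_cancel_right _ _ hMunit]
    rwa [hM, Matrix.mul_add, Matrix.mul_smul, Matrix.mul_one] at h
  have hK : IsUnit ((1 - G * H) * P).det :=
    isUnit_det_of_right_inverse (posterior_mul_information hr hP hgain)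
  have hKG : ((1 - G * H) * P)⁻¹ * G = r⁻¹ • Hᵀ := by
    rw [eq_inv_smul_iff₀ hr, ← Matrix.mul_smul, ← posterior_mul_transpose hgain,
      nonsing_inv_mul_cancel_left _ _ hK]
  have hGT : Gᵀ = M⁻¹ * (H * P) := by
    rw [hG, transpose_mul, transpose_mul, transpose_transpose, transpose_nonsing_inv, hMsymm,
      hPsymm]
  have hS : H * P * Hᵀ = M - r • 1 := by rw [hM, add_sub_cancel_right]
  rw [Matrix.mul_assoc, hKG, Matrix.mul_smul, hGT, Matrix.mul_assoc, hS, Matrix.mul_sub,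
    nonsing_inv_mul _ hMunit, Matrix.mul_smul, Matrix.mul_one, smul_sub, inv_smul_smul₀ hr,
    sub_add_cancel]

end Kalman

/-- `Gᵀ ((I - G H) P)⁻¹ G + M⁻¹ ⪯ (3/r) I` in the Loewner order:
for all `ζ`, `ζᵀ Gᵀ ((I - G H) P)⁻¹ G ζ + ζᵀ M⁻¹ ζ ≤ 3 ‖ζ‖² / r`. -/
theorem kalman_three_over_r_bound {n m : ℕ} (hn : 0 < n) (hm : 0 < m)
    (P : Matrix (Fin m) (Fin m) ℝ) (H : Matrix (Fin n) (Fin m) ℝ) (r : ℝ)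
    (hP : P.PosDef) (hr : 0 < r)
    (M : Matrix (Fin n) (Fin n) ℝ)
    (hM : M = H * P * Hᵀ + r • (1 : Matrix (Fin n) (Fin n) ℝ))
    (G : Matrix (Fin m) (Fin n) ℝ) (hG : G = P * Hᵀ * M⁻¹) :
    ∀ ζ : Fin n → ℝ,
      ζ ⬝ᵥ ((Gᵀ * ((1 - G * H) * P)⁻¹ * G) *ᵥ ζ) + ζ ⬝ᵥ (M⁻¹ *ᵥ ζ) ≤
        3 * (ζ ⬝ᵥ ζ) / r := by
  intro ζ
  have hMpos : M.PosDef := by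
    rw [hM]
    refine PosDef.posSemidef_add ?_ (PosDef.one.smul hr)
    simpa [conjTranspose_eq_transpose_of_trivial] using
      hP.posSemidef.mul_mul_conjTranspose_same H
  have hsymm : Pᵀ = P := by
    simpa [conjTranspose_eq_transpose_of_trivial] using hP.isHermitian.eq
  have hMsymm : Mᵀ = M := by
    simpa [conjTranspose_eq_transpose_of_trivial] using hMpos.isHermitian.eq
  have hMunit : IsUnit M.det := (isUnit_iff_isUnit_det M).1 hMpos.isUnit
  have hPunit : IsUnit P.det := (isUnit_iff_isUnit_det P).1 hP.isUnit
  have hsum := transpose_gain_mul_inv_mul_gain_add_inv hr.ne' hPunit hMunit hsymm hMsymm hM hG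
  rw [← dotProduct_add, ← add_mulVec, hsum, smul_mulVec, one_mulVec, dotProduct_smul, smul_eq_mul,
    div_eq_inv_mul]
  have hζ : 0 ≤ ζ ⬝ᵥ ζ := by simpa using dotProduct_star_self_nonneg ζ
  exact mul_le_mul_of_nonneg_left (by linarith) (inv_nonneg.2 hr.le)
end

section
/- Let χ ∈ ℝ^m, ζ ∈ ℝ^n, set e = H χ + ζ and χ' = (I_m − G H) χ − G ζ. Then the Lyapunov increment identity holds exactly: χ'ᵀ ((I_m − G H) P)⁻¹ χ' − χᵀ P⁻¹ χ = ζᵀ ( Gᵀ ((I_m − G H) P)⁻¹ G + M⁻¹ ) ζ − eᵀ M⁻¹ e. -/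
open Matrix

theorem mulVec_dotProduct_eq {R m n : Type*} [CommSemiring R] [Fintype m] [Fintype n]
    (A : Matrix m n R) (x : n → R) (y : m → R) :
    (A *ᵥ x) ⬝ᵥ y = x ⬝ᵥ (Aᵀ *ᵥ y) := by
  rw [dotProduct_mulVec, vecMul_transpose]

/-- The Kalman update matrix `1 - G * H` is invertible, with inverse `1 + r⁻¹ • (P * Hᵀ * H)`. -/
theorem isUnit_det_kalman_update {K m n : Type*} [Field K] [Fintype m] [DecidableEq m]
    [Fintype n] [DecidableEq n] (P : Matrix m m K) (H : Matrix n m K) {r : K} (hr : r ≠ 0)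
    {M : Matrix n n K} (hM : M = H * P * Hᵀ + r • (1 : Matrix n n K)) (hMu : IsUnit M.det)
    {G : Matrix m n K} (hG : G = P * Hᵀ * M⁻¹) : IsUnit (1 - G * H).det := by
  have hGM : G * M = P * Hᵀ := by rw [hG, nonsing_inv_mul_cancel_right _ _ hMu]
  have hGH : G * H * (P * Hᵀ * H) = P * Hᵀ * H - r • (G * H) := by
    calc G * H * (P * Hᵀ * H) = G * (H * P * Hᵀ) * H := by simp only [Matrix.mul_assoc]
      _ = G * (M - r • 1) * H := by rw [hM, add_sub_cancel_right]
      _ = P * Hᵀ * H - r • (G * H) := by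
        rw [Matrix.mul_sub, hGM, Matrix.mul_smul, Matrix.mul_one, Matrix.sub_mul, Matrix.smul_mul]
  refine isUnit_det_of_right_inverse (B := 1 + r⁻¹ • (P * Hᵀ * H)) ?_
  rw [Matrix.sub_mul, Matrix.one_mul, Matrix.mul_add, Matrix.mul_one, Matrix.mul_smul, hGH,
    smul_sub, smul_smul, inv_mul_cancel₀ hr, one_smul]
  abel

/-- the exact Lyapunov increment identity:
`χ'ᵀ ((I - G H) P)⁻¹ χ' - χᵀ P⁻¹ χ
  = ζᵀ (Gᵀ ((I - G H) P)⁻¹ G + M⁻¹) ζ - eᵀ M⁻¹ e`. -/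
theorem kalman_lyapunov_identity {n m : ℕ} (hn : 0 < n) (hm : 0 < m)
    (P : Matrix (Fin m) (Fin m) ℝ) (H : Matrix (Fin n) (Fin m) ℝ) (r : ℝ)
    (hP : P.PosDef) (hr : 0 < r)
    (M : Matrix (Fin n) (Fin n) ℝ)
    (hM : M = H * P * Hᵀ + r • (1 : Matrix (Fin n) (Fin n) ℝ))
    (G : Matrix (Fin m) (Fin n) ℝ) (hG : G = P * Hᵀ * M⁻¹)
    (χ : Fin m → ℝ) (ζ : Fin n → ℝ)
    (e : Fin n → ℝ) (he : e = H *ᵥ χ + ζ)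
    (χ' : Fin m → ℝ) (hχ' : χ' = (1 - G * H) *ᵥ χ - G *ᵥ ζ) :
    χ' ⬝ᵥ (((1 - G * H) * P)⁻¹ *ᵥ χ') - χ ⬝ᵥ (P⁻¹ *ᵥ χ) =
      ζ ⬝ᵥ ((Gᵀ * ((1 - G * H) * P)⁻¹ * G + M⁻¹) *ᵥ ζ) - e ⬝ᵥ (M⁻¹ *ᵥ e) := by
  have hPt : Pᵀ = P := by simpa [conjTranspose_eq_transpose_of_trivial] using hP.isHermitian.eq
  have hMpd : M.PosDef := by
    rw [hM]
    refine Matrix.PosDef.posSemidef_add ?_ (Matrix.PosDef.one.smul hr)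
    simpa [conjTranspose_eq_transpose_of_trivial] using hP.posSemidef.mul_mul_conjTranspose_same H
  have hMt : Mᵀ = M := by
    simpa [conjTranspose_eq_transpose_of_trivial] using hMpd.isHermitian.eq
  have hPu : IsUnit P.det := (isUnit_iff_isUnit_det P).mp hP.isUnit
  have hMu : IsUnit M.det := (isUnit_iff_isUnit_det M).mp hMpd.isUnit
  have hMit : M⁻¹ᵀ = M⁻¹ := by rw [transpose_nonsing_inv, hMt]
  have hPit : P⁻¹ᵀ = P⁻¹ := by rw [transpose_nonsing_inv, hPt]
  have hGt : Gᵀ = M⁻¹ * H * P := by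
    rw [hG, transpose_mul, transpose_mul, hMit, hPt, transpose_transpose, Matrix.mul_assoc]
  have hGP : Gᵀ * P⁻¹ = M⁻¹ * H := by rw [hGt, mul_nonsing_inv_cancel_right _ _ hPu]
  have hPG : P⁻¹ * G = Hᵀ * M⁻¹ := by
    rw [hG, Matrix.mul_assoc, nonsing_inv_mul_cancel_left _ _ hPu]
  have hAu : IsUnit (1 - G * H).det := isUnit_det_kalman_update P H hr.ne' hM hMu hG
  set A := 1 - G * H with hA
  set Q := (A * P)⁻¹ with hQ
  have hSt : (A * P)ᵀ = A * P := by
    rw [hA, Matrix.sub_mul, transpose_sub, transpose_mul, transpose_mul, transpose_mul, hGt, hG,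
      hPt]
    simp only [Matrix.one_mul, transpose_one, Matrix.mul_one, Matrix.mul_assoc]
  have hQt : Qᵀ = Q := by rw [hQ, transpose_nonsing_inv, hSt]
  have hQA : Q * A = P⁻¹ := by
    rw [hQ, Matrix.mul_inv_rev, nonsing_inv_mul_cancel_right _ _ hAu]
  have hAQ : Aᵀ * Q = P⁻¹ := by
    rw [← hPit, ← hQA, transpose_mul, hQt]
  have hAP : Aᵀ * P⁻¹ = P⁻¹ - Hᵀ * M⁻¹ * H := by
    rw [hA, transpose_sub, transpose_one, transpose_mul, Matrix.sub_mul, Matrix.one_mul,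
      Matrix.mul_assoc, hGP, Matrix.mul_assoc]
  have hL : χ' ⬝ᵥ (Q *ᵥ χ') = χ ⬝ᵥ ((P⁻¹ - Hᵀ * M⁻¹ * H) *ᵥ χ)
      - χ ⬝ᵥ ((Hᵀ * M⁻¹) *ᵥ ζ) - ζ ⬝ᵥ ((M⁻¹ * H) *ᵥ χ) + ζ ⬝ᵥ ((Gᵀ * Q * G) *ᵥ ζ) := by
    rw [hχ', mulVec_sub, mulVec_mulVec, mulVec_mulVec, hQA, sub_dotProduct, dotProduct_sub,
      dotProduct_sub, mulVec_dotProduct_eq, mulVec_dotProduct_eq, mulVec_dotProduct_eq,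
      mulVec_dotProduct_eq, mulVec_mulVec, mulVec_mulVec, mulVec_mulVec, mulVec_mulVec, hAP, hGP,
      ← Matrix.mul_assoc, hAQ, hPG, ← Matrix.mul_assoc]
    ring
  have hR : e ⬝ᵥ (M⁻¹ *ᵥ e) = χ ⬝ᵥ ((Hᵀ * M⁻¹ * H) *ᵥ χ)
      + χ ⬝ᵥ ((Hᵀ * M⁻¹) *ᵥ ζ) + ζ ⬝ᵥ ((M⁻¹ * H) *ᵥ χ) + ζ ⬝ᵥ (M⁻¹ *ᵥ ζ) := by
    rw [he, mulVec_add, mulVec_mulVec, add_dotProduct, dotProduct_add, dotProduct_add,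
      mulVec_dotProduct_eq, mulVec_dotProduct_eq, mulVec_mulVec, mulVec_mulVec, ← Matrix.mul_assoc]
    ring
  rw [hL, hR, sub_mulVec, dotProduct_sub, add_mulVec, dotProduct_add]
  ring
end

section
/- Let χ ∈ ℝ^m, ζ ∈ ℝ^n, set e = H χ + ζ and χ' = (I_m − G H) χ − G ζ, and let q ≥ 0. Define the updated covariance P' = (I_m − G H) P + q·I_m (a symmetric positive definite matrix). Then the one-step Lyapunov inequality holds: χ'ᵀ (P')⁻¹ χ' − χᵀ P⁻¹ χ ≤ 3‖ζ‖²/r − ‖e‖² / ( Tr(H P Hᵀ) + n·r ). -/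
open Matrix

open scoped MatrixOrder Matrix.Norms.L2Operator in
/-- Cauchy–Schwarz for a positive semidefinite matrix, summed over the standard basis. -/
theorem Matrix.PosSemidef.mulVec_dotProduct_self_le {ι : Type*} [Fintype ι]
    {M : Matrix ι ι ℝ} (hM : M.PosSemidef) (f : ι → ℝ) :
    (M *ᵥ f) ⬝ᵥ (M *ᵥ f) ≤ M.trace * (f ⬝ᵥ (M *ᵥ f)) := by
  classical
  obtain ⟨C, rfl⟩ := CStarAlgebra.nonneg_iff_eq_star_mul_self.mp hM.nonneg
  rw [star_eq_conjTranspose, conjTranspose_eq_transpose_of_trivial]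
  have hf : f ⬝ᵥ ((Cᵀ * C) *ᵥ f) = (C *ᵥ f) ⬝ᵥ (C *ᵥ f) := by
    rw [← mulVec_mulVec, dotProduct_mulVec, vecMul_transpose]
  rw [hf, ← mulVec_mulVec]
  rw [trace, Finset.sum_mul]
  refine Finset.sum_le_sum fun i _ => ?_
  have h := Finset.sum_mul_sq_le_sq_mul_sq Finset.univ (fun k => C k i) (C *ᵥ f)
  simpa only [pow_two, mulVec, dotProduct, diag_apply, mul_apply, transpose_apply] using h

/-- Inversion is antitone on positive definite matrices, in quadratic-form version. -/
theorem Matrix.PosDef.dotProduct_inv_add_mulVec_le {ι : Type*} [Fintype ι] [DecidableEq ι]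
    {A D : Matrix ι ι ℝ} (hA : A.PosDef) (hD : D.PosSemidef) (z : ι → ℝ) :
    (A *ᵥ z) ⬝ᵥ ((A + D)⁻¹ *ᵥ (A *ᵥ z)) ≤ z ⬝ᵥ (A *ᵥ z) := by
  have hdet : IsUnit (A + D).det := (isUnit_iff_isUnit_det _).mp (hA.add_posSemidef hD).isUnit
  have hAt : Aᵀ = A := hA.isHermitian
  set y := (A + D)⁻¹ *ᵥ (A *ᵥ z) with hy
  have hAy : A *ᵥ y + D *ᵥ y = A *ᵥ z := by
    rw [← add_mulVec, hy, mulVec_mulVec, mul_nonsing_inv _ hdet, one_mulVec]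
  have hDy : 0 ≤ y ⬝ᵥ (D *ᵥ y) := by simpa using hD.dotProduct_mulVec_nonneg y
  have hsq : 0 ≤ (y - z) ⬝ᵥ (A *ᵥ (y - z)) := by
    simpa using hA.posSemidef.dotProduct_mulVec_nonneg (y - z)
  have hsymm : z ⬝ᵥ (A *ᵥ y) = y ⬝ᵥ (A *ᵥ z) := by
    rw [dotProduct_mulVec, ← mulVec_transpose, hAt, dotProduct_comm]
  have hyz : y ⬝ᵥ (A *ᵥ y) + y ⬝ᵥ (D *ᵥ y) = y ⬝ᵥ (A *ᵥ z) := by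
    rw [← dotProduct_add, hAy]
  rw [mulVec_sub, sub_dotProduct, dotProduct_sub, dotProduct_sub, hsymm] at hsq
  rw [dotProduct_comm]
  linarith

/-- one-step Lyapunov inequality:
`χ'ᵀ P'⁻¹ χ' - χᵀ P⁻¹ χ ≤ 3 ‖ζ‖² / r - ‖e‖² / (Tr(H P Hᵀ) + n r)`,
where `P' = (I - G H) P + q I` with `q ≥ 0`. -/
theorem kalman_lyapunov_inequality {n m : ℕ} (hn : 0 < n) (hm : 0 < m)
    (P : Matrix (Fin m) (Fin m) ℝ) (H : Matrix (Fin n) (Fin m) ℝ) (r : ℝ)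
    (hP : P.PosDef) (hr : 0 < r)
    (M : Matrix (Fin n) (Fin n) ℝ)
    (hM : M = H * P * Hᵀ + r • (1 : Matrix (Fin n) (Fin n) ℝ))
    (G : Matrix (Fin m) (Fin n) ℝ) (hG : G = P * Hᵀ * M⁻¹)
    (χ : Fin m → ℝ) (ζ : Fin n → ℝ)
    (e : Fin n → ℝ) (he : e = H *ᵥ χ + ζ)
    (χ' : Fin m → ℝ) (hχ' : χ' = (1 - G * H) *ᵥ χ - G *ᵥ ζ)
    (q : ℝ) (hq : 0 ≤ q)
    (P' : Matrix (Fin m) (Fin m) ℝ)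
    (hP' : P' = (1 - G * H) * P + q • (1 : Matrix (Fin m) (Fin m) ℝ)) :
    χ' ⬝ᵥ (P'⁻¹ *ᵥ χ') - χ ⬝ᵥ (P⁻¹ *ᵥ χ) ≤
      3 * (ζ ⬝ᵥ ζ) / r - (e ⬝ᵥ e) / ((H * P * Hᵀ).trace + n * r) := by
  have hPt : Pᵀ = P := hP.isHermitian
  have hPdet : IsUnit P.det := (isUnit_iff_isUnit_det _).mp hP.isUnit
  have hHPH : (H * P * Hᵀ).PosSemidef := by
    simpa using hP.posSemidef.mul_mul_conjTranspose_same H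
  have hMpos : M.PosDef := by
    rw [hM]
    exact PosDef.posSemidef_add hHPH (PosDef.one.smul hr)
  have hMdet : IsUnit M.det := (isUnit_iff_isUnit_det _).mp hMpos.isUnit
  have hGM : G * M = P * Hᵀ := by
    rw [hG, Matrix.mul_assoc, nonsing_inv_mul _ hMdet, Matrix.mul_one]
  have hHPH_eq : H * P * Hᵀ = M - r • (1 : Matrix (Fin n) (Fin n) ℝ) := by
    rw [hM, add_sub_cancel_right]
  have hgain : (1 - G * H) * P * Hᵀ = r • G := by
    have : (1 - G * H) * P * Hᵀ = P * Hᵀ - G * (H * P * Hᵀ) := by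
      simp only [Matrix.sub_mul, Matrix.one_mul, Matrix.mul_assoc]
    rw [this, hHPH_eq, Matrix.mul_sub, hGM]
    simp
  have hA : ((1 - G * H) * P).PosDef := by
    have hB : (P⁻¹ + r⁻¹ • (Hᵀ * H)).PosDef := by
      refine hP.inv.add_posSemidef (PosSemidef.smul ?_ (inv_nonneg.mpr hr.le))
      simpa using posSemidef_conjTranspose_mul_self H
    have hAB : ((1 - G * H) * P) * (P⁻¹ + r⁻¹ • (Hᵀ * H)) = 1 := by
      rw [Matrix.mul_add, Matrix.mul_assoc _ P, mul_nonsing_inv _ hPdet, Matrix.mul_smul,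
        ← Matrix.mul_assoc _ Hᵀ, hgain, Matrix.smul_mul, smul_smul, inv_mul_cancel₀ hr.ne']
      simp
    rw [← inv_eq_left_inv hAB]
    exact hB.inv
  set p := P⁻¹ *ᵥ χ with hp
  set f := M⁻¹ *ᵥ e with hf
  have hPp : P *ᵥ p = χ := by rw [hp, mulVec_mulVec, mul_nonsing_inv _ hPdet, one_mulVec]
  have hMf : M *ᵥ f = e := by rw [hf, mulVec_mulVec, mul_nonsing_inv _ hMdet, one_mulVec]
  set w := p - r⁻¹ • (Hᵀ *ᵥ ζ) with hw
  have hAw : ((1 - G * H) * P) *ᵥ w = χ' := by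
    rw [hw, mulVec_sub, mulVec_smul, mulVec_mulVec ζ, hgain, ← mulVec_mulVec, hPp, smul_mulVec,
      smul_smul, inv_mul_cancel₀ hr.ne', one_smul, hχ']
  have hχ'f : χ' = χ - P *ᵥ (Hᵀ *ᵥ f) := by
    have hGe : P *ᵥ (Hᵀ *ᵥ f) = G *ᵥ e := by
      rw [hf, hG]
      simp only [mulVec_mulVec, Matrix.mul_assoc]
    rw [hGe, hχ', he, sub_mulVec, one_mulVec, mulVec_add, mulVec_mulVec]
    abel
  have hHf : H *ᵥ (P *ᵥ (Hᵀ *ᵥ f)) = e - r • f := by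
    rw [mulVec_mulVec, mulVec_mulVec, hHPH_eq, sub_mulVec, hMf, smul_mulVec,
      one_mulVec]
  have hpf : p ⬝ᵥ (P *ᵥ (Hᵀ *ᵥ f)) = (H *ᵥ χ) ⬝ᵥ f := by
    rw [dotProduct_mulVec, ← mulVec_transpose, hPt, hPp, dotProduct_mulVec, vecMul_transpose]
  have hζ (x : Fin m → ℝ) : (Hᵀ *ᵥ ζ) ⬝ᵥ x = ζ ⬝ᵥ (H *ᵥ x) := by
    rw [mulVec_transpose, dotProduct_mulVec]
  have hform : w ⬝ᵥ χ' = χ ⬝ᵥ p + (ζ ⬝ᵥ ζ) / r - e ⬝ᵥ f := by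
    rw [hw, sub_dotProduct, smul_dotProduct, hζ, hχ'f, dotProduct_sub, hpf, mulVec_sub, hHf,
      dotProduct_comm p χ, he]
    simp only [dotProduct_sub, dotProduct_add, add_dotProduct, dotProduct_smul, smul_eq_mul]
    field_simp
    ring
  have hupd : χ' ⬝ᵥ (P'⁻¹ *ᵥ χ') ≤ w ⬝ᵥ χ' := by
    have h := hA.dotProduct_inv_add_mulVec_le (PosSemidef.one.smul hq) w
    rwa [hAw, ← hP'] at h
  have htrace : (H * P * Hᵀ).trace + n * r = M.trace := by
    simp [hM, mul_comm]
  have htrace_pos : 0 < M.trace := by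
    have : Nonempty (Fin n) := ⟨⟨0, hn⟩⟩
    exact hMpos.trace_pos
  have hgap : (e ⬝ᵥ e) / M.trace ≤ e ⬝ᵥ f := by
    rw [div_le_iff₀' htrace_pos]
    have h := hMpos.posSemidef.mulVec_dotProduct_self_le f
    rwa [hMf, dotProduct_comm f e] at h
  have hζ_nonneg : 0 ≤ (ζ ⬝ᵥ ζ) / r :=
    div_nonneg (Finset.sum_nonneg fun i _ => mul_self_nonneg (ζ i)) hr.le
  rw [htrace, mul_div_assoc]
  linarith
end

section
/- Suppose in addition that Tr(H P Hᵀ) > 0, that the measurement-noise level is chosen as r = 3·Tr(H P Hᵀ)/n (the choice made in line 8 of Algorithm 1), that ‖ζ‖ ≤ ζ̄ for some ζ̄ ≥ 0, and that the update is triggered, i.e. ‖e‖² > 4·n·ζ̄². Then for any q ≥ 0 and P' = (I_m − G H) P + q·I_m, the Lyapunov function strictly decreases: χ'ᵀ (P')⁻¹ χ' − χᵀ P⁻¹ χ ≤ (4·n·ζ̄² − ‖e‖²) / (4·Tr(H P Hᵀ)) < 0. -/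
open Matrix

/-- Inversion reverses the Loewner order on quadratic forms. -/
theorem Matrix.PosDef.dotProduct_inv_mulVec_anti {k : Type*} [Fintype k] [DecidableEq k]
    {A B : Matrix k k ℝ} (hA : A.PosDef) (hB : B.PosDef)
    (hAB : ∀ y : k → ℝ, y ⬝ᵥ (A *ᵥ y) ≤ y ⬝ᵥ (B *ᵥ y)) (x : k → ℝ) :
    x ⬝ᵥ (B⁻¹ *ᵥ x) ≤ x ⬝ᵥ (A⁻¹ *ᵥ x) := by
  have hAw : A *ᵥ (A⁻¹ *ᵥ x) = x := by
    rw [mulVec_mulVec, mul_nonsing_inv _ ((isUnit_iff_isUnit_det A).1 hA.isUnit), one_mulVec]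
  have hBy : B *ᵥ (B⁻¹ *ᵥ x) = x := by
    rw [mulVec_mulVec, mul_nonsing_inv _ ((isUnit_iff_isUnit_det B).1 hB.isUnit), one_mulVec]
  set w := A⁻¹ *ᵥ x
  set y := B⁻¹ *ᵥ x
  have hsymm : w ⬝ᵥ (A *ᵥ y) = y ⬝ᵥ x := by
    have hT : Aᵀ = A := by simpa using hA.isHermitian.eq
    rw [dotProduct_mulVec, ← mulVec_transpose, hT, hAw, dotProduct_comm]
  have hnonneg : 0 ≤ (w - y) ⬝ᵥ (A *ᵥ (w - y)) := by
    simpa using hA.posSemidef.dotProduct_mulVec_nonneg (w - y)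
  have hle := hAB y
  rw [hBy] at hle
  simp only [mulVec_sub, sub_dotProduct, dotProduct_sub, hAw, hsymm] at hnonneg
  rw [dotProduct_comm x y, dotProduct_comm x w]
  linarith

/-- The quadratic form of a positive semidefinite matrix is bounded by its trace. -/
theorem Matrix.PosSemidef.dotProduct_mulVec_le_trace_mul {k : Type*} [Fintype k]
    {A : Matrix k k ℝ} (hA : A.PosSemidef) (y : k → ℝ) :
    y ⬝ᵥ (A *ᵥ y) ≤ A.trace * (y ⬝ᵥ y) := by
  obtain ⟨l, v, rfl⟩ := posSemidef_iff_eq_sum_vecMulVec.1 hA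
  have hform : y ⬝ᵥ ((∑ i, vecMulVec (v i) (star (v i))) *ᵥ y) = ∑ i, (v i ⬝ᵥ y) ^ 2 := by
    simp [sum_mulVec, sum_dotProduct, vecMulVec_mulVec, sq, dotProduct_comm y]
  have htrace : (∑ i, vecMulVec (v i) (star (v i))).trace = ∑ i, v i ⬝ᵥ v i := by
    simp [trace_sum, trace_vecMulVec]
  rw [hform, htrace, Finset.sum_mul]
  refine Finset.sum_le_sum fun i _ => ?_
  simpa [dotProduct, sq] using Finset.sum_mul_sq_le_sq_mul_sq Finset.univ (v i) y

/-- with the measurement-noise choice `r = 3 Tr(H P Hᵀ) / n`,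
a residual bound `‖ζ‖ ≤ ζ̄`, and a triggered update `‖e‖² > 4 n ζ̄²`, the
Lyapunov function strictly decreases:
`χ'ᵀ P'⁻¹ χ' - χᵀ P⁻¹ χ ≤ (4 n ζ̄² - ‖e‖²) / (4 Tr(H P Hᵀ)) < 0`. -/
theorem kalman_lyapunov_strict_decrease {n m : ℕ} (hn : 0 < n) (hm : 0 < m)
    (P : Matrix (Fin m) (Fin m) ℝ) (H : Matrix (Fin n) (Fin m) ℝ) (r : ℝ)
    (hP : P.PosDef) (hr : 0 < r)
    (M : Matrix (Fin n) (Fin n) ℝ)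
    (hM : M = H * P * Hᵀ + r • (1 : Matrix (Fin n) (Fin n) ℝ))
    (G : Matrix (Fin m) (Fin n) ℝ) (hG : G = P * Hᵀ * M⁻¹)
    (χ : Fin m → ℝ) (ζ : Fin n → ℝ)
    (e : Fin n → ℝ) (he : e = H *ᵥ χ + ζ)
    (χ' : Fin m → ℝ) (hχ' : χ' = (1 - G * H) *ᵥ χ - G *ᵥ ζ)
    (htr : 0 < (H * P * Hᵀ).trace)
    (hrsel : r = 3 * (H * P * Hᵀ).trace / n)
    (ζbar : ℝ) (hζbar : 0 ≤ ζbar)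
    (hζ : Real.sqrt (ζ ⬝ᵥ ζ) ≤ ζbar)
    (htrig : 4 * n * ζbar ^ 2 < e ⬝ᵥ e)
    (q : ℝ) (hq : 0 ≤ q)
    (P' : Matrix (Fin m) (Fin m) ℝ)
    (hP' : P' = (1 - G * H) * P + q • (1 : Matrix (Fin m) (Fin m) ℝ)) :
    χ' ⬝ᵥ (P'⁻¹ *ᵥ χ') - χ ⬝ᵥ (P⁻¹ *ᵥ χ) ≤
        (4 * n * ζbar ^ 2 - e ⬝ᵥ e) / (4 * (H * P * Hᵀ).trace) ∧
    (4 * n * ζbar ^ 2 - e ⬝ᵥ e) / (4 * (H * P * Hᵀ).trace) < 0 := by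
  have hPu : P * P⁻¹ = 1 := mul_nonsing_inv _ ((isUnit_iff_isUnit_det P).1 hP.isUnit)
  have hPT : Pᵀ = P := by simpa using hP.isHermitian.eq
  have hA : (H * P * Hᵀ).PosSemidef := by
    simpa using hP.posSemidef.mul_mul_conjTranspose_same H
  have hMpd : M.PosDef := by
    rw [hM]
    exact PosDef.posSemidef_add hA (PosDef.one.smul hr)
  have hMu : M⁻¹ * M = 1 := nonsing_inv_mul _ ((isUnit_iff_isUnit_det M).1 hMpd.isUnit)
  have hMT : M⁻¹ᵀ = M⁻¹ := by simpa using hMpd.inv.isHermitian.eq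
  have hGM : G * M = P * Hᵀ := by rw [hG, Matrix.mul_assoc, hMu, Matrix.mul_one]
  have hGA : G * (H * P * Hᵀ) = P * Hᵀ - r • G := by
    rw [← hGM, hM, Matrix.mul_add]; simp
  -- the information form of the updated covariance
  set N : Matrix (Fin m) (Fin m) ℝ := P⁻¹ + r⁻¹ • (Hᵀ * H) with hN
  have hNpd : N.PosDef := by
    refine hP.inv.add_posSemidef (PosSemidef.smul ?_ (inv_nonneg.2 hr.le))
    simpa using posSemidef_conjTranspose_mul_self H
  have hSN : (1 - G * H) * P * N = 1 := by
    have hGH : G * H * P * (Hᵀ * H) = P * Hᵀ * H - r • (G * H) := by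
      rw [← Matrix.smul_mul, ← Matrix.sub_mul, ← hGA]; simp only [Matrix.mul_assoc]
    rw [hN, Matrix.mul_add, Matrix.mul_assoc _ P P⁻¹, hPu, Matrix.mul_one, Matrix.mul_smul,
      Matrix.sub_mul, Matrix.sub_mul, hGH, Matrix.one_mul, ← Matrix.mul_assoc P, sub_sub_cancel,
      smul_smul, inv_mul_cancel₀ hr.ne', one_smul, sub_add_cancel]
  have hS : (1 - G * H) * P = N⁻¹ := (inv_eq_left_inv hSN).symm
  have hSinv : ((1 - G * H) * P)⁻¹ = N := inv_eq_right_inv hSN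
  have hSpd : ((1 - G * H) * P).PosDef := hS ▸ hNpd.inv
  have hqpsd : (q • (1 : Matrix (Fin m) (Fin m) ℝ)).PosSemidef := PosSemidef.one.smul hq
  have hP'pd : P'.PosDef := hP' ▸ hSpd.add_posSemidef hqpsd
  have hdiscard : χ' ⬝ᵥ (P'⁻¹ *ᵥ χ') ≤ χ' ⬝ᵥ (N *ᵥ χ') := by
    rw [← hSinv]
    refine hSpd.dotProduct_inv_mulVec_anti hP'pd (fun y => ?_) χ'
    have hy : 0 ≤ y ⬝ᵥ ((q • (1 : Matrix (Fin m) (Fin m) ℝ)) *ᵥ y) := by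
      simpa using hqpsd.dotProduct_mulVec_nonneg y
    rw [hP', add_mulVec, dotProduct_add]
    linarith
  have hNG : N * G = r⁻¹ • Hᵀ := by
    have hSH : (1 - G * H) * P * Hᵀ = r • G := by
      rw [Matrix.sub_mul, Matrix.sub_mul, Matrix.one_mul,
        show G * H * P * Hᵀ = G * (H * P * Hᵀ) by simp only [Matrix.mul_assoc], hGA,
        sub_sub_cancel]
    have hG' : G = r⁻¹ • ((1 - G * H) * P * Hᵀ) := by
      rw [hSH, smul_smul, inv_mul_cancel₀ hr.ne', one_smul]
    have hNS : N * ((1 - G * H) * P) = 1 := mul_eq_one_comm.1 hSN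
    rw [hG', Matrix.mul_smul, ← Matrix.mul_assoc, hNS, Matrix.one_mul]
  have hχe : χ' = χ - G *ᵥ e := by
    rw [hχ', he, sub_mulVec, one_mulVec, mulVec_add, ← mulVec_mulVec]; abel
  have hNχ : N *ᵥ χ' = P⁻¹ *ᵥ χ - r⁻¹ • (Hᵀ *ᵥ ζ) := by
    rw [hχe, mulVec_sub, mulVec_mulVec, hNG, hN, he, add_mulVec, smul_mulVec, smul_mulVec,
      mulVec_add, ← mulVec_mulVec, smul_add]
    abel
  have hGT : Gᵀ = M⁻¹ * (H * P) := by
    rw [hG, transpose_mul, transpose_mul, transpose_transpose, hPT, hMT]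
  have hGP : (G *ᵥ e) ⬝ᵥ (P⁻¹ *ᵥ χ) = e ⬝ᵥ (M⁻¹ *ᵥ (e - ζ)) := by
    rw [dotProduct_comm, dotProduct_mulVec, ← mulVec_transpose, mulVec_mulVec, hGT,
      Matrix.mul_assoc, Matrix.mul_assoc, hPu, Matrix.mul_one, ← mulVec_mulVec, dotProduct_comm,
      he, add_sub_cancel_right]
  have hGζ : (G *ᵥ e) ⬝ᵥ (Hᵀ *ᵥ ζ) = e ⬝ᵥ ζ - r * (e ⬝ᵥ (M⁻¹ *ᵥ ζ)) := by
    have hMA : M⁻¹ * (H * P * Hᵀ) = 1 - r • M⁻¹ := by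
      rw [← hMu, hM, Matrix.mul_add]; simp
    rw [dotProduct_comm, dotProduct_mulVec, ← mulVec_transpose, mulVec_mulVec, hGT,
      Matrix.mul_assoc, hMA, dotProduct_comm, sub_mulVec, one_mulVec, smul_mulVec, dotProduct_sub,
      dotProduct_smul, smul_eq_mul]
  have hχζ : χ ⬝ᵥ (Hᵀ *ᵥ ζ) = e ⬝ᵥ ζ - ζ ⬝ᵥ ζ := by
    rw [dotProduct_mulVec, vecMul_transpose, he, add_dotProduct, add_sub_cancel_right]
  have hV : χ' ⬝ᵥ (N *ᵥ χ') = χ ⬝ᵥ (P⁻¹ *ᵥ χ) + (ζ ⬝ᵥ ζ) / r - e ⬝ᵥ (M⁻¹ *ᵥ e) := by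
    rw [hNχ, hχe, sub_dotProduct, dotProduct_sub, dotProduct_sub, dotProduct_smul,
      dotProduct_smul, hGP, hGζ, hχζ, mulVec_sub, dotProduct_sub, smul_eq_mul, smul_eq_mul]
    field_simp
    ring
  set T := (H * P * Hᵀ).trace with hT
  have hn1 : (1 : ℝ) ≤ n := by exact_mod_cast hn
  have hζsq : ζ ⬝ᵥ ζ ≤ ζbar ^ 2 := (Real.sqrt_le_left hζbar).1 hζ
  have hrT : r ≤ 3 * T := hrsel ▸ div_le_self (by positivity) hn1
  have hnoise : (ζ ⬝ᵥ ζ) / r ≤ n * ζbar ^ 2 / T := by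
    rw [div_le_div_iff₀ hr htr, hrsel]
    calc (ζ ⬝ᵥ ζ) * T ≤ ζbar ^ 2 * T := by gcongr
      _ ≤ 3 * (ζbar ^ 2 * T) := by nlinarith [mul_nonneg (sq_nonneg ζbar) htr.le]
      _ = n * ζbar ^ 2 * (3 * T / n) := by field_simp
  have hinnov : (e ⬝ᵥ e) / (4 * T) ≤ e ⬝ᵥ (M⁻¹ *ᵥ e) := by
    have h4T : (0 : ℝ) < 4 * T := by positivity
    have hinv : ((4 * T) • (1 : Matrix (Fin n) (Fin n) ℝ))⁻¹ = (4 * T)⁻¹ • 1 :=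
      inv_eq_left_inv (by
        rw [Matrix.smul_mul, Matrix.one_mul, smul_smul, inv_mul_cancel₀ h4T.ne', one_smul])
    have hle := hMpd.dotProduct_inv_mulVec_anti (PosDef.one.smul h4T) (fun y => ?_) e
    · rw [hinv, smul_mulVec, one_mulVec, dotProduct_smul, smul_eq_mul] at hle
      rwa [div_eq_inv_mul]
    · have hy : 0 ≤ y ⬝ᵥ y := by simpa using dotProduct_star_self_nonneg y
      have hAy := hA.dotProduct_mulVec_le_trace_mul y
      rw [hM, add_mulVec, dotProduct_add, smul_mulVec, smul_mulVec, one_mulVec, dotProduct_smul,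
        dotProduct_smul, smul_eq_mul, smul_eq_mul]
      nlinarith [mul_le_mul_of_nonneg_right hrT hy]
  refine ⟨?_, div_neg_of_neg_of_pos (by linarith) (by positivity)⟩
  have hsplit : (4 * n * ζbar ^ 2 - e ⬝ᵥ e) / (4 * T) =
      n * ζbar ^ 2 / T - (e ⬝ᵥ e) / (4 * T) := by
    field_simp
  linarith
end

section
/- (Boundedness of weights, Theorem 1 statement 1.) Let (P_t) be a sequence of m×m real symmetric positive definite matrices with Tr(P_t) ≤ B for all t, and let (χ_t) be a sequence in ℝ^m such that the Lyapunov values V_t = χ_tᵀ P_t⁻¹ χ_t are nonincreasing in t. Then for all t, ‖χ_t‖² ≤ B · χ_1ᵀ P_1⁻¹ χ_1; in particular, if P_1 = p_1·I_m with p_1 > 0, then ‖χ_t‖² ≤ (B/p_1)·‖χ_1‖², so the parameter deviations stay bounded throughout training. -/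
open Matrix

/-- The Cauchy–Schwarz inequality for the form defined by a positive definite matrix, against a
standard basis vector. -/
lemma Matrix.PosDef.mulVec_apply_sq_le {n : Type*} [Fintype n] [DecidableEq n]
    {P : Matrix n n ℝ} (hP : P.PosDef) (y : n → ℝ) (i : n) :
    (P *ᵥ y) i ^ 2 ≤ P i i * (y ⬝ᵥ (P *ᵥ y)) := by
  have ha : 0 < P i i := hP.diag_pos
  have hsymm : y ⬝ᵥ P.col i = (P *ᵥ y) i := by
    have h : Pᵀ = P := by simpa using hP.isHermitian.eq
    rw [dotProduct_comm]
    change Pᵀ i ⬝ᵥ y = _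
    rw [h]
    rfl
  have hz := hP.posSemidef.dotProduct_mulVec_nonneg
    (P i i • y - (P *ᵥ y) i • Pi.single i 1)
  simp only [star_trivial, mulVec_sub, mulVec_smul, mulVec_single_one, sub_dotProduct,
    dotProduct_sub, smul_dotProduct, dotProduct_smul, single_one_dotProduct, smul_eq_mul,
    hsymm, col_apply] at hz
  refine le_of_mul_le_mul_left ?_ ha
  linarith

/-- The squared Euclidean norm is at most the trace of `P` times the form defined by `P⁻¹`. -/
lemma Matrix.PosDef.dotProduct_self_le_trace_mul {n : Type*} [Fintype n] [DecidableEq n]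
    {P : Matrix n n ℝ} (hP : P.PosDef) (x : n → ℝ) :
    x ⬝ᵥ x ≤ P.trace * (x ⬝ᵥ (P⁻¹ *ᵥ x)) := by
  have hx : P *ᵥ (P⁻¹ *ᵥ x) = x := by
    rw [mulVec_mulVec, mul_nonsing_inv _ ((isUnit_iff_isUnit_det P).mp hP.isUnit), one_mulVec]
  rw [trace, Finset.sum_mul, dotProduct]
  refine Finset.sum_le_sum fun i _ => ?_
  have h := hP.mulVec_apply_sq_le (P⁻¹ *ᵥ x) i
  rwa [hx, dotProduct_comm, sq] at h

/-- Theorem 1, statement 1: if `Tr(P_t) ≤ B` for all `t` and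
the Lyapunov values `V_t = χ_tᵀ P_t⁻¹ χ_t` are nonincreasing, then
`‖χ_t‖² ≤ B · χ_1ᵀ P_1⁻¹ χ_1` for all `t`; in particular if `P_1 = p₁ I`
with `p₁ > 0` then `‖χ_t‖² ≤ (B / p₁) ‖χ_1‖²`.  (Indices start at `0`,
which plays the role of time `1`.) -/
theorem bounded_weights_of_lyapunov {m : ℕ} (hm : 0 < m) (B : ℝ) (hB : 0 < B)
    (P : ℕ → Matrix (Fin m) (Fin m) ℝ) (hP : ∀ t, (P t).PosDef)
    (htr : ∀ t, (P t).trace ≤ B)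
    (χ : ℕ → Fin m → ℝ)
    (V : ℕ → ℝ) (hV : ∀ t, V t = χ t ⬝ᵥ ((P t)⁻¹ *ᵥ χ t))
    (hmono : ∀ t, V (t + 1) ≤ V t) :
    ∀ t, χ t ⬝ᵥ χ t ≤ B * (χ 0 ⬝ᵥ ((P 0)⁻¹ *ᵥ χ 0)) ∧
      (∀ p₁ : ℝ, 0 < p₁ → P 0 = p₁ • (1 : Matrix (Fin m) (Fin m) ℝ) →
        χ t ⬝ᵥ χ t ≤ (B / p₁) * (χ 0 ⬝ᵥ χ 0)) := by
  intro t
  have hpos : 0 ≤ χ t ⬝ᵥ ((P t)⁻¹ *ᵥ χ t) := by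
    simpa using (hP t).inv.posSemidef.dotProduct_mulVec_nonneg (χ t)
  have hle : χ t ⬝ᵥ ((P t)⁻¹ *ᵥ χ t) ≤ χ 0 ⬝ᵥ ((P 0)⁻¹ *ᵥ χ 0) := by
    rw [← hV, ← hV]
    exact antitone_nat_of_succ_le hmono t.zero_le
  have hbound : χ t ⬝ᵥ χ t ≤ B * (χ 0 ⬝ᵥ ((P 0)⁻¹ *ᵥ χ 0)) :=
    calc χ t ⬝ᵥ χ t ≤ (P t).trace * (χ t ⬝ᵥ ((P t)⁻¹ *ᵥ χ t)) :=
          (hP t).dotProduct_self_le_trace_mul (χ t)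
      _ ≤ B * (χ t ⬝ᵥ ((P t)⁻¹ *ᵥ χ t)) := mul_le_mul_of_nonneg_right (htr t) hpos
      _ ≤ B * (χ 0 ⬝ᵥ ((P 0)⁻¹ *ᵥ χ 0)) := mul_le_mul_of_nonneg_left hle hB.le
  refine ⟨hbound, fun p₁ hp₁ h => ?_⟩
  have hinv : (P 0)⁻¹ = p₁⁻¹ • (1 : Matrix (Fin m) (Fin m) ℝ) := by
    refine inv_eq_right_inv ?_
    rw [h, smul_mul_smul_comm, mul_inv_cancel₀ hp₁.ne', one_mul, one_smul]
  rwa [hinv, smul_mulVec, one_mulVec, dotProduct_smul, smul_eq_mul, ← mul_assoc,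
    ← div_eq_mul_inv] at hbound
end

section
/- (Convergence of the loss to an interval, Theorem 1 statement 2.) Let (V_t) and (ℓ_t) be sequences of nonnegative real numbers, let a ≥ 0 and c > 0, and suppose that for every t: if ℓ_t > a then V_{t+1} ≤ V_t − c·(ℓ_t − a), and if ℓ_t ≤ a then V_{t+1} ≤ V_t. Then Σ_t max(0, ℓ_t − a) ≤ V_1 / c, and consequently limsup_{t→∞} ℓ_t ≤ a; i.e., the loss sequence converges to the interval [0, a]. -/
open Filter

/-- A nonnegative sequence that drops by at least `c * u t` at each step bounds the partial sums
of `u` by `V 0 / c`. -/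
theorem sum_range_le_div_of_succ_le_sub {V u : ℕ → ℝ} {c : ℝ} (hV : ∀ t, 0 ≤ V t) (hc : 0 < c)
    (h : ∀ t, V (t + 1) ≤ V t - c * u t) (T : ℕ) :
    ∑ t ∈ Finset.range T, u t ≤ V 0 / c := by
  have key : c * ∑ t ∈ Finset.range T, u t ≤ V 0 - V T := by
    rw [Finset.mul_sum, ← Finset.sum_range_sub']
    exact Finset.sum_le_sum fun t _ => by linarith [h t]
  rw [le_div_iff₀' hc]
  linarith [hV T]

/-- Theorem 1, statement 2: if a nonnegative Lyapunov sequence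
decreases by at least `c (ℓ_t - a)` whenever `ℓ_t > a` and does not increase
otherwise, then `Σ_t max(0, ℓ_t - a) ≤ V_1 / c` and `limsup ℓ_t ≤ a`, i.e.
the losses converge to the interval `[0, a]`.  (Indices start at `0`, which
plays the role of time `1`.) -/
theorem loss_converges_to_interval (V ℓ : ℕ → ℝ)
    (hVnonneg : ∀ t, 0 ≤ V t) (hℓnonneg : ∀ t, 0 ≤ ℓ t)
    (a c : ℝ) (ha : 0 ≤ a) (hc : 0 < c)
    (hdec : ∀ t, a < ℓ t → V (t + 1) ≤ V t - c * (ℓ t - a))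
    (hstay : ∀ t, ℓ t ≤ a → V (t + 1) ≤ V t) :
    (∀ T : ℕ, ∑ t ∈ Finset.range T, max 0 (ℓ t - a) ≤ V 0 / c) ∧
    limsup ℓ atTop ≤ a := by
  have hstep (t : ℕ) : V (t + 1) ≤ V t - c * max 0 (ℓ t - a) := by
    rcases lt_or_ge a (ℓ t) with h | h
    · simpa [max_eq_right (sub_nonneg.2 h.le)] using hdec t h
    · simpa [max_eq_left (sub_nonpos.2 h)] using hstay t h
  have hsum := sum_range_le_div_of_succ_le_sub hVnonneg hc hstep
  refine ⟨hsum, ?_⟩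
  have hlim : Tendsto (fun t => a + max 0 (ℓ t - a)) atTop (nhds a) := by
    simpa using (summable_of_sum_range_le (fun t => le_max_left 0 (ℓ t - a))
      hsum).tendsto_atTop_zero.const_add a
  rw [← hlim.limsup_eq]
  refine limsup_le_limsup (.of_forall fun t => ?_)
    (isBoundedUnder_of ⟨0, hℓnonneg⟩).isCoboundedUnder_le hlim.isBoundedUnder_le
  linarith [le_max_right 0 (ℓ t - a)]
end

section
/- (Exp-concavity of the squared loss.) Fix a positive integer n and a target d ∈ ℝ^n with all coordinates in [−1, 1]. Then the function F(x) = exp( −‖d − x‖² / (8n) ) is concave on the box [−1, 1]^n ⊂ ℝ^n, where ‖·‖ is the Euclidean norm; i.e., the squared loss x ↦ ‖d − x‖² is (1/(8n))-exp-concave on [−1,1]^n. -/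
/-- The Gaussian profile `u ↦ exp (-u² / c)` is concave on `[0, R]` when `2 R² ≤ c`. -/
theorem concaveOn_exp_neg_sq_div {c R : ℝ} (hc : 0 < c) (hR : 2 * R ^ 2 ≤ c) :
    ConcaveOn ℝ (Set.Icc 0 R) (fun u => Real.exp (-u ^ 2 / c)) := by
  have hd (u : ℝ) : HasDerivAt (fun u => Real.exp (-u ^ 2 / c))
      (Real.exp (-u ^ 2 / c) * (-(2 * u) / c)) u := by
    simpa using (((hasDerivAt_pow 2 u).neg.div_const c).exp)
  have hd2 (u : ℝ) : HasDerivAt (fun u => Real.exp (-u ^ 2 / c) * (-(2 * u) / c))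
      (Real.exp (-u ^ 2 / c) * (-(2 * u) / c) * (-(2 * u) / c) +
        Real.exp (-u ^ 2 / c) * (-2 / c)) u := by
    have h : HasDerivAt (fun u : ℝ => -(2 * u) / c) (-2 / c) u := by
      simpa using (((hasDerivAt_id u).const_mul 2).neg.div_const c)
    exact (hd u).mul h
  refine concaveOn_of_hasDerivWithinAt2_nonpos (convex_Icc 0 R) (by fun_prop)
    (fun u _ => (hd u).hasDerivWithinAt) (fun u _ => (hd2 u).hasDerivWithinAt) fun u hu => ?_
  rw [interior_Icc] at hu
  have hu2 : 2 * u ^ 2 ≤ c := by nlinarith [hu.1, hu.2]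
  have h : Real.exp (-u ^ 2 / c) * (-(2 * u) / c) * (-(2 * u) / c) +
      Real.exp (-u ^ 2 / c) * (-2 / c) =
      Real.exp (-u ^ 2 / c) * (2 * (2 * u ^ 2 - c) / c ^ 2) := by
    field_simp
    ring
  rw [h]
  exact mul_nonpos_of_nonneg_of_nonpos (Real.exp_pos _).le
    (div_nonpos_of_nonpos_of_nonneg (by linarith) (by positivity))

/-- `x ↦ exp (-‖d - x‖² / c)` is concave on any convex subset of the closed ball of radius `R`
around `d` when `2 R² ≤ c`. -/
theorem concaveOn_exp_neg_norm_sub_sq_div {E : Type*} [SeminormedAddCommGroup E]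
    [NormedSpace ℝ E] {s : Set E} (hs : Convex ℝ s) {c R : ℝ} (hc : 0 < c) (hR : 2 * R ^ 2 ≤ c)
    (d : E) (hd : ∀ x ∈ s, ‖d - x‖ ≤ R) :
    ConcaveOn ℝ s (fun x => Real.exp (-‖d - x‖ ^ 2 / c)) := by
  refine ⟨hs, fun x hx y hy a b ha hb hab => ?_⟩
  refine ((concaveOn_exp_neg_sq_div hc hR).2 ⟨norm_nonneg _, hd x hx⟩ ⟨norm_nonneg _, hd y hy⟩
    ha hb hab).trans ?_
  have h : ‖d - (a • x + b • y)‖ ≤ a • ‖d - x‖ + b • ‖d - y‖ := by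
    have e : d - (a • x + b • y) = a • (d - x) + b • (d - y) := by
      nth_rewrite 1 [← one_smul ℝ d, ← hab]
      module
    rw [e]
    refine (norm_add_le _ _).trans_eq ?_
    rw [norm_smul_of_nonneg ha, norm_smul_of_nonneg hb, smul_eq_mul, smul_eq_mul]
  dsimp only
  gcongr

/-- exp-concavity of the squared loss.  For a target
`d ∈ [-1,1]^n`, the function `x ↦ exp(-‖d - x‖² / (8n))` is concave on the
box `[-1,1]^n` of `ℝ^n` (Euclidean norm); i.e. the squared loss is
`(1/(8n))`-exp-concave there. -/
theorem sq_loss_exp_concave (n : ℕ) (hn : 0 < n)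
    (d : EuclideanSpace ℝ (Fin n)) (hd : ∀ i, d i ∈ Set.Icc (-1 : ℝ) 1) :
    ConcaveOn ℝ {x : EuclideanSpace ℝ (Fin n) | ∀ i, x i ∈ Set.Icc (-1 : ℝ) 1}
      (fun x => Real.exp (-‖d - x‖ ^ 2 / (8 * n))) := by
  have hn' : (0 : ℝ) < n := Nat.cast_pos.mpr hn
  refine concaveOn_exp_neg_norm_sub_sq_div (R := √(4 * n)) ?_ (by positivity) ?_ d ?_
  · intro x hx y hy a b ha hb hab i
    simpa using convex_Icc (-1 : ℝ) 1 (hx i) (hy i) ha hb hab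
  · rw [Real.sq_sqrt (by positivity)]
    linarith
  · intro x hx
    refine Real.le_sqrt_of_sq_le ?_
    rw [EuclideanSpace.real_norm_sq_eq]
    calc ∑ i, (d - x) i ^ 2 ≤ ∑ _i : Fin n, (4 : ℝ) := by
          refine Finset.sum_le_sum fun i _ => ?_
          rw [PiLp.sub_apply]
          nlinarith [(hd i).1, (hd i).2, (hx i).1, (hx i).2]
      _ = 4 * n := by simp [mul_comm]
end

section
/- (Weighted aggregation step.) Fix a positive integer n and N ≥ 1 experts. Let d ∈ [−1,1]^n, let x_1, …, x_N ∈ [−1,1]^n, and let w_1, …, w_N > 0. Define the aggregated prediction x̄ = (Σ_{j=1}^N w_j x_j) / (Σ_{k=1}^N w_k). Then Σ_{j=1}^N w_j · exp( −‖d − x_j‖² / (8n) ) ≤ (Σ_{k=1}^N w_k) · exp( −‖d − x̄‖² / (8n) ). -/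
open Finset

/-- The tangent-line inequality for the concave function `t ↦ exp (-t ^ 2 / 2)` on `[0, 1]`. -/
theorem exp_half_sq_sub_sq_le {s t : ℝ} (hs : 0 ≤ s) (hs1 : s ≤ 1) (ht : 0 ≤ t) (ht1 : t ≤ 1) :
    Real.exp ((s ^ 2 - t ^ 2) / 2) ≤ 1 + s ^ 2 - s * t := by
  rcases le_total s t with h | h
  · set y := (t ^ 2 - s ^ 2) / 2 with hy
    have hy0 : 0 ≤ y := by rw [hy]; nlinarith
    have hexp : Real.exp (-y) ≤ 1 - y + y ^ 2 / 2 := by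
      have hq := Real.quadratic_le_exp_of_nonneg hy0
      rw [Real.exp_neg, inv_le_iff_one_le_mul₀ (Real.exp_pos y)]
      have hpos : 0 ≤ 1 - y + y ^ 2 / 2 := by nlinarith [sq_nonneg (y - 1)]
      nlinarith [mul_le_mul_of_nonneg_left hq hpos, sq_nonneg (y ^ 2)]
    have hneg : (s ^ 2 - t ^ 2) / 2 = -y := by rw [hy]; ring
    rw [hneg]
    refine hexp.trans ?_
    have hm : (t + s) ^ 2 ≤ 4 := by nlinarith
    rw [hy]
    nlinarith [mul_le_mul_of_nonneg_left hm (sq_nonneg (t - s))]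
  · set y := (s ^ 2 - t ^ 2) / 2 with hy
    have hy0 : 0 ≤ y := by rw [hy]; nlinarith
    have hy1 : y ≤ 1 := by rw [hy]; nlinarith
    have hexp := Real.exp_bound' hy0 hy1 (n := 3) (by norm_num)
    norm_num [Finset.sum_range_succ, Nat.factorial] at hexp
    refine hexp.trans ?_
    have hm0 : 0 ≤ s + t := by linarith
    have hms : (s + t) * s ≤ 2 := by nlinarith
    have hm : (s + t) ^ 2 ≤ 4 := by nlinarith
    have hd : 0 ≤ s - t := by linarith
    have hc := mul_le_mul_of_nonneg_left hm (mul_nonneg hd hm0)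
    have hk : (s + t) ^ 2 / 8 + (s - t) * (s + t) ^ 3 / 36 ≤ 1 / 2 := by nlinarith
    have hf := mul_le_mul_of_nonneg_left hk (sq_nonneg (s - t))
    rw [hy]
    nlinarith

/-- The Gaussian `z ↦ exp (-‖z‖ ^ 2 / (2 * r ^ 2))` lies below its tangent planes on the ball of
radius `r`. -/
theorem exp_neg_norm_sq_le_tangent {E : Type*} [NormedAddCommGroup E] [InnerProductSpace ℝ E]
    {r : ℝ} (hr : 0 < r) {u z : E} (hu : ‖u‖ ≤ r) (hz : ‖z‖ ≤ r) :
    Real.exp (-‖z‖ ^ 2 / (2 * r ^ 2)) ≤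
      Real.exp (-‖u‖ ^ 2 / (2 * r ^ 2)) * (1 + (‖u‖ ^ 2 - inner ℝ u z) / r ^ 2) := by
  have h := exp_half_sq_sub_sq_le (s := ‖u‖ / r) (t := ‖z‖ / r) (by positivity)
    ((div_le_one hr).2 hu) (by positivity) ((div_le_one hr).2 hz)
  have hle : 1 + (‖u‖ / r) ^ 2 - ‖u‖ / r * (‖z‖ / r) ≤
      1 + (‖u‖ ^ 2 - inner ℝ u z) / r ^ 2 := by
    have hi : inner ℝ u z / r ^ 2 ≤ ‖u‖ * ‖z‖ / r ^ 2 := by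
      gcongr
      exact real_inner_le_norm u z
    have e : ‖u‖ / r * (‖z‖ / r) = ‖u‖ * ‖z‖ / r ^ 2 := by field_simp
    rw [e, div_pow, sub_div]
    linarith
  have e : -‖z‖ ^ 2 / (2 * r ^ 2) =
      -‖u‖ ^ 2 / (2 * r ^ 2) + ((‖u‖ / r) ^ 2 - (‖z‖ / r) ^ 2) / 2 := by
    field_simp
    ring
  rw [e, Real.exp_add]
  exact mul_le_mul_of_nonneg_left (h.trans hle) (Real.exp_pos _).le

theorem concaveOn_exp_neg_norm_sq {E : Type*} [NormedAddCommGroup E] [InnerProductSpace ℝ E]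
    {r : ℝ} (hr : 0 < r) :
    ConcaveOn ℝ (Metric.closedBall (0 : E) r) fun z => Real.exp (-‖z‖ ^ 2 / (2 * r ^ 2)) := by
  refine ⟨convex_closedBall 0 r, fun x hx y hy a b ha hb hab => ?_⟩
  have hu := convex_closedBall (0 : E) r hx hy ha hb hab
  rw [mem_closedBall_zero_iff] at hx hy hu
  set u := a • x + b • y with hu_def
  have h1 := mul_le_mul_of_nonneg_left (exp_neg_norm_sq_le_tangent hr hu hx) ha
  have h2 := mul_le_mul_of_nonneg_left (exp_neg_norm_sq_le_tangent hr hu hy) hb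
  have hi : ‖u‖ ^ 2 = a * inner ℝ u x + b * inner ℝ u y := by
    rw [← real_inner_self_eq_norm_sq]
    nth_rewrite 2 [hu_def]
    rw [inner_add_right, inner_smul_right, inner_smul_right]
  simp only [smul_eq_mul]
  refine (add_le_add h1 h2).trans_eq ?_
  obtain rfl : b = 1 - a := by linarith
  generalize Real.exp (-‖u‖ ^ 2 / (2 * r ^ 2)) = c
  rw [hi]
  ring

/-- weighted aggregation step.  For targets and expert
predictions in `[-1,1]^n` and positive weights,
`Σ_j w_j exp(-‖d - x_j‖²/(8n)) ≤ (Σ_k w_k) exp(-‖d - x̄‖²/(8n))`, where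
`x̄ = (Σ_j w_j x_j) / (Σ_k w_k)` is the aggregated prediction. -/
theorem weighted_aggregation_step (n N : ℕ) (hn : 0 < n) (hN : 0 < N)
    (d : EuclideanSpace ℝ (Fin n)) (hd : ∀ i, d i ∈ Set.Icc (-1 : ℝ) 1)
    (x : Fin N → EuclideanSpace ℝ (Fin n))
    (hx : ∀ j i, x j i ∈ Set.Icc (-1 : ℝ) 1)
    (w : Fin N → ℝ) (hw : ∀ j, 0 < w j) :
    ∑ j, w j * Real.exp (-‖d - x j‖ ^ 2 / (8 * n)) ≤
      (∑ k, w k) *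
        Real.exp (-‖d - (∑ k, w k)⁻¹ • ∑ j, w j • x j‖ ^ 2 / (8 * n)) := by
  have hn' : (0 : ℝ) < n := Nat.cast_pos.2 hn
  have : Nonempty (Fin N) := ⟨⟨0, hN⟩⟩
  have hW : 0 < ∑ k, w k := Finset.sum_pos (fun j _ => hw j) Finset.univ_nonempty
  have hr : 0 < √(4 * n : ℝ) := Real.sqrt_pos.2 (by positivity)
  have hr2 : 2 * √(4 * n : ℝ) ^ 2 = 8 * n := by
    rw [Real.sq_sqrt (by positivity)]
    ring
  have hball : ∀ j ∈ Finset.univ, d - x j ∈ Metric.closedBall 0 √(4 * n : ℝ) := by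
    intro j _
    rw [mem_closedBall_zero_iff]
    refine Real.le_sqrt_of_sq_le ?_
    rw [EuclideanSpace.real_norm_sq_eq]
    calc ∑ i, (d - x j) i ^ 2 ≤ ∑ _i : Fin n, (4 : ℝ) := by
          refine Finset.sum_le_sum fun i _ => ?_
          obtain ⟨h1, h2⟩ := hd i
          obtain ⟨h3, h4⟩ := hx j i
          rw [PiLp.sub_apply]
          nlinarith
      _ = 4 * n := by simp [mul_comm]
  have hJ := (concaveOn_exp_neg_norm_sq hr).le_map_centerMass (fun j _ => (hw j).le) hW hball
  have hmean : Finset.univ.centerMass w (fun j => d - x j) =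
      d - (∑ k, w k)⁻¹ • ∑ j, w j • x j := by
    simp only [Finset.centerMass, smul_sub, Finset.sum_sub_distrib, ← Finset.sum_smul]
    rw [smul_smul, inv_mul_cancel₀ hW.ne', one_smul]
  rw [hmean, hr2, Finset.centerMass, smul_eq_mul, inv_mul_le_iff₀ hW] at hJ
  simpa only [Function.comp_def, hr2, smul_eq_mul] using hJ
end
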